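/- arXiv:2511.11474 — 3 statements merged into one kernel-verified Lean document; each statement's English description precedes it below -/
import Mathlib

section
/- For m ∈ ℕ with m ≥ 1 and n ∈ ℕ, the integral operator on L²([t₀,T]) with kernel f(t,τ) = tⁿ·τ^{m+n}·𝟙(τ ≤ t) + τⁿ·t^{m+n}·𝟙(t < τ) is a trace class operator. -/
open MeasureTheory Set

noncomputable section

variable {𝕜 H : Type*} [RCLike 𝕜] [NormedAddCommGroup H] [InnerProductSpace 𝕜 H]

def IsHilbertSchmidt (𝕜 : Type*) [RCLike 𝕜] {H : Type*} [NormedAddCommGroup H]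
    [InnerProductSpace 𝕜 H] (F : H →L[𝕜] H) : Prop :=
  ∃ b : HilbertBasis ℕ 𝕜 H, Summable fun i => ‖F (b i)‖ ^ 2

/-- A trace class operator: a composition of two Hilbert–Schmidt operators. -/
def IsTraceClass (𝕜 : Type*) [RCLike 𝕜] {H : Type*} [NormedAddCommGroup H]
    [InnerProductSpace 𝕜 H] (F : H →L[𝕜] H) : Prop :=
  ∃ A B : H →L[𝕜] H, IsHilbertSchmidt 𝕜 A ∧ IsHilbertSchmidt 𝕜 B ∧ F = A.comp B

lemma ts_infinite (t₀ T : ℝ) (ht : t₀ < T) :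
    ¬ FiniteDimensional ℝ (Lp ℝ 2 (volume.restrict (Icc t₀ T))) := by
  intro hfin
  have hmem : ∀ p : Polynomial ℝ,
      MemLp (fun x => p.eval x) 2 (volume.restrict (Icc t₀ T)) := by
    intro p
    obtain ⟨C, hC⟩ := isCompact_Icc.exists_bound_of_continuousOn
      (f := fun x => p.eval x) (s := Icc t₀ T) p.continuous.continuousOn
    refine MemLp.of_bound p.continuous.aestronglyMeasurable C ?_
    exact (ae_restrict_iff' measurableSet_Icc).2 (Filter.Eventually.of_forall hC)
  let L : Polynomial ℝ →ₗ[ℝ] Lp ℝ 2 (volume.restrict (Icc t₀ T)) :=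
    { toFun := fun p => (hmem p).toLp _
      map_add' := fun p q => by
        rw [← MemLp.toLp_add]
        congr 1
        ext x
        simp
      map_smul' := fun c p => by
        simp only [RingHom.id_apply]
        rw [← MemLp.toLp_const_smul]
        congr 1
        ext x
        simp }
  have hinj : Function.Injective L := by
    rw [injective_iff_map_eq_zero]
    intro p hp
    by_contra hne
    have h1 : (fun x => p.eval x) =ᵐ[volume.restrict (Icc t₀ T)] 0 := by
      have := (hmem p).coeFn_toLp
      have h0 : (hmem p).toLp _ = 0 := hp
      rw [h0] at this
      exact this.symm.trans (Lp.coeFn_zero _ _ _)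
    have h2 : ∀ᵐ x ∂(volume.restrict (Icc t₀ T)), p.eval x ≠ 0 := by
      apply ae_restrict_of_ae
      rw [ae_iff]
      simp only [not_not]
      have : {x | p.eval x = 0}.Finite := by
        refine (p.roots.toFinset.finite_toSet).subset ?_
        intro x hx
        simpa [hne] using hx
      exact this.measure_zero _
    have h3 : ∀ᵐ x ∂(volume.restrict (Icc t₀ T)), False := by
      filter_upwards [h1, h2] with x hx1 hx2 using hx2 hx1
    rw [Filter.eventually_false_iff_eq_bot, ae_eq_bot, Measure.restrict_eq_zero] at h3
    simp at h3
    linarith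
  exact Polynomial.not_finite (R := ℝ) (Module.Finite.of_injective L hinj)

lemma ts_basis {E : Type*} [NormedAddCommGroup E] [InnerProductSpace ℝ E] [CompleteSpace E]
    [TopologicalSpace.SeparableSpace E] (hE : ¬ FiniteDimensional ℝ E) :
    Nonempty (HilbertBasis ℕ ℝ E) := by
  obtain ⟨w, b, hb⟩ := exists_hilbertBasis ℝ E
  have hinf : Infinite w := by
    by_contra h
    rw [not_infinite_iff_finite] at h
    have := Fintype.ofFinite w
    exact hE b.toOrthonormalBasis.toBasis.finiteDimensional_of_finite
  have hc : Countable w := by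
    refine Pairwise.countable_of_isOpen_disjoint (s := fun i : w => Metric.ball (b i) (1/2)) ?_
      (fun i => Metric.isOpen_ball) (fun i => ⟨b i, by simp⟩)
    intro i j hij
    apply Metric.ball_disjoint_ball
    have h1 : ‖b i - b j‖ ^ 2 = 2 := by
      rw [norm_sub_sq_real, b.orthonormal.1 i, b.orthonormal.1 j, b.orthonormal.2 hij]
      norm_num
    rw [dist_eq_norm]
    nlinarith [norm_nonneg (b i - b j)]
  obtain ⟨e⟩ := nonempty_equiv_of_countable (α := ℕ) (β := w)
  refine ⟨HilbertBasis.mk (v := fun i => b (e i)) (b.orthonormal.comp _ e.injective) ?_⟩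
  have : range (fun i => b (e i)) = range b := e.surjective.range_comp b
  rw [this, b.dense_span]

lemma ts_kernel {μ : Measure ℝ} [IsFiniteMeasure μ] (k : ℝ → ℝ → ℝ)
    (hk : Measurable (Function.uncurry k)) (C : ℝ) (hC : ∀ t s, |k t s| ≤ C)
    (b : HilbertBasis ℕ ℝ (Lp ℝ 2 μ)) :
    ∃ K : Lp ℝ 2 μ →L[ℝ] Lp ℝ 2 μ, (∀ g : Lp ℝ 2 μ,
      (K g : ℝ → ℝ) =ᵐ[μ] fun t => ∫ s, k t s * g s ∂μ) ∧ IsHilbertSchmidt ℝ K := by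
  have hC0 : 0 ≤ C := (abs_nonneg _).trans (hC 0 0)
  have hkt : ∀ t, MemLp (k t) 2 μ := fun t =>
    MemLp.of_bound (hk.comp measurable_prodMk_left).aestronglyMeasurable C
      (Filter.Eventually.of_forall (hC t))
  set κ : ℝ → Lp ℝ 2 μ := fun t => (hkt t).toLp _ with hκ
  have hin : ∀ t (g : Lp ℝ 2 μ), ∫ s, k t s * g s ∂μ = inner ℝ g (κ t) := by
    intro t g
    rw [L2.inner_def]
    apply integral_congr_ae
    filter_upwards [(hkt t).coeFn_toLp] with s hs
    simp [hκ, hs]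
  set M : ℝ := (measureUnivNNReal μ : ℝ) ^ (2 : ENNReal).toReal⁻¹ * C with hM
  have hM0 : 0 ≤ M := by positivity
  have hκM : ∀ t, ‖κ t‖ ≤ M := by
    intro t
    apply Lp.norm_le_of_ae_bound hC0
    filter_upwards [(hkt t).coeFn_toLp] with s hs
    simp only [hκ]
    rw [hs]
    exact hC t s
  have hmeas : ∀ g : Lp ℝ 2 μ, StronglyMeasurable fun t => inner ℝ g (κ t) := by
    intro g
    simp_rw [← hin]
    apply StronglyMeasurable.integral_prod_right (f := fun t s => k t s * g s)
    exact (hk.mul ((Lp.stronglyMeasurable g).measurable.comp measurable_snd)).stronglyMeasurable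
  have hbd : ∀ (g : Lp ℝ 2 μ) t, ‖inner ℝ g (κ t)‖ ≤ M * ‖g‖ := by
    intro g t
    refine (norm_inner_le_norm _ _).trans ?_
    rw [mul_comm]
    gcongr
    exact hκM t
  have hLp : ∀ g : Lp ℝ 2 μ, MemLp (fun t => inner ℝ g (κ t)) 2 μ := fun g =>
    MemLp.of_bound (hmeas g).aestronglyMeasurable (M * ‖g‖) (Filter.Eventually.of_forall (hbd g))
  let L : Lp ℝ 2 μ →ₗ[ℝ] Lp ℝ 2 μ :=
    { toFun := fun g => (hLp g).toLp _
      map_add' := fun p q => by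
        rw [← MemLp.toLp_add]
        congr 1
        ext x
        simp [inner_add_left]
      map_smul' := fun c p => by
        simp only [RingHom.id_apply]
        rw [← MemLp.toLp_const_smul]
        congr 1
        ext x
        simp [inner_smul_left] }
  have hL : ∀ g, ‖L g‖ ≤ ((measureUnivNNReal μ : ℝ) ^ (2 : ENNReal).toReal⁻¹ * M) * ‖g‖ := by
    intro g
    rw [mul_assoc]
    apply Lp.norm_le_of_ae_bound (by positivity)
    filter_upwards [(hLp g).coeFn_toLp] with s hs
    change ‖((hLp g).toLp _ : ℝ → ℝ) s‖ ≤ _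
    rw [hs]
    exact hbd g s
  refine ⟨L.mkContinuous _ hL, ?_, b, ?_⟩
  · intro g
    simp_rw [hin]
    exact (hLp g).coeFn_toLp
  · refine summable_of_sum_le (c := μ.real univ * M ^ 2) (fun i => by positivity) ?_
    intro S
    have hsq : ∀ g : Lp ℝ 2 μ, ‖L g‖ ^ 2 = ∫ t, ‖inner ℝ g (κ t)‖ ^ 2 ∂μ := by
      intro g
      rw [← real_inner_self_eq_norm_sq, L2.inner_def]
      apply integral_congr_ae
      filter_upwards [(hLp g).coeFn_toLp] with s hs
      change inner ℝ (((hLp g).toLp _ : ℝ → ℝ) s) (((hLp g).toLp _ : ℝ → ℝ) s) = _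
      rw [hs, real_inner_self_eq_norm_sq]
    have hint : ∀ g : Lp ℝ 2 μ, Integrable (fun t => ‖inner ℝ g (κ t)‖ ^ 2) μ := fun g =>
      (hLp g).integrable_norm_pow (by norm_num)
    simp only [LinearMap.mkContinuous_apply, hsq]
    rw [← integral_finsetSum _ (fun i _ => hint (b i))]
    calc _ ≤ ∫ t, M ^ 2 ∂μ := by
          apply integral_mono (integrable_finsetSum _ (fun i _ => hint (b i)))
            (integrable_const _)
          intro t
          refine (b.orthonormal.sum_inner_products_le (κ t)).trans ?_
          exact pow_le_pow_left₀ (norm_nonneg _) (hκM t) 2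
      _ = _ := by simp

lemma ts_comp {μ : Measure ℝ} [IsFiniteMeasure μ] (a b : ℝ → ℝ → ℝ)
    (ha : Measurable (Function.uncurry a)) (C : ℝ) (hC : ∀ t s, |a t s| ≤ C)
    (hb : Measurable (Function.uncurry b)) (D : ℝ) (hD : ∀ t s, |b t s| ≤ D)
    (A B : Lp ℝ 2 μ →L[ℝ] Lp ℝ 2 μ)
    (hA : ∀ g : Lp ℝ 2 μ, (A g : ℝ → ℝ) =ᵐ[μ] fun t => ∫ s, a t s * g s ∂μ)
    (hB : ∀ g : Lp ℝ 2 μ, (B g : ℝ → ℝ) =ᵐ[μ] fun t => ∫ s, b t s * g s ∂μ)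
    (g : Lp ℝ 2 μ) :
    (A (B g) : ℝ → ℝ) =ᵐ[μ] fun t => ∫ τ, (∫ s, a t s * b s τ ∂μ) * g τ ∂μ := by
  filter_upwards [hA (B g)] with t ht
  rw [ht]
  have h1 : ∫ s, a t s * (B g) s ∂μ = ∫ s, ∫ τ, a t s * b s τ * g τ ∂μ ∂μ := by
    apply integral_congr_ae
    filter_upwards [hB g] with s hs
    rw [hs, ← integral_const_mul]
    simp_rw [mul_assoc]
  rw [h1, integral_integral_swap]
  · simp_rw [integral_mul_const]
  · have hg : Integrable (fun x => g x) μ := (Lp.memLp g).integrable (by norm_num)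
    have hg2 : Integrable (fun z : ℝ × ℝ => g z.2) (μ.prod μ) := hg.comp_snd μ
    refine hg2.bdd_mul (c := C * D) (f := fun z : ℝ × ℝ => a t z.1 * b z.1 z.2) ?_ ?_
    · exact ((ha.comp (measurable_const.prodMk measurable_fst)).mul hb).aestronglyMeasurable
    · refine Filter.Eventually.of_forall fun z => ?_
      rw [norm_mul]
      exact mul_le_mul (hC _ _) (hD _ _) (norm_nonneg _) ((abs_nonneg _).trans (hC 0 0))

/-- Weight with `∫_{t₀}^{(u+T)/2} w = u^m`. -/
def tsW (t₀ T : ℝ) (m : ℕ) (s : ℝ) : ℝ :=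
  if 2 * s ≤ t₀ + T then 2 * t₀ ^ m / (T - t₀) else 2 * m * (2 * s - T) ^ (m - 1)

lemma tsW_integral (t₀ T : ℝ) (ht : t₀ < T) (m : ℕ) (u : ℝ) (hu : u ∈ Icc t₀ T) :
    ∫ s in Icc t₀ T, (if 2 * s ≤ u + T then 1 else 0) * tsW t₀ T m s = u ^ m := by
  obtain ⟨hu1, hu2⟩ := hu
  have h1 : ∫ s in Icc t₀ T, (if 2 * s ≤ u + T then 1 else 0) * tsW t₀ T m s
      = ∫ s in t₀..((u + T) / 2), tsW t₀ T m s := by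
    rw [intervalIntegral.integral_of_le (by linarith), ← integral_Icc_eq_integral_Ioc]
    have : Icc t₀ ((u + T) / 2) = Icc t₀ T ∩ Iic ((u + T) / 2) := by
      ext s
      simp only [mem_Icc, mem_inter_iff, mem_Iic]
      constructor
      · rintro ⟨h, h'⟩
        exact ⟨⟨h, by linarith⟩, h'⟩
      · rintro ⟨⟨h, _⟩, h'⟩
        exact ⟨h, h'⟩
    rw [this, ← setIntegral_indicator measurableSet_Iic]
    congr 1
    ext s
    by_cases hs : 2 * s ≤ u + T
    · have : s ∈ Iic ((u + T) / 2) := by simp only [mem_Iic]; linarith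
      simp [hs, this]
    · have : s ∉ Iic ((u + T) / 2) := by simp only [mem_Iic]; intro h; exact hs (by linarith)
      simp [hs, this]
  have e1 : ∀ s ∈ Ioc t₀ ((t₀ + T) / 2), tsW t₀ T m s = 2 * t₀ ^ m / (T - t₀) := by
    intro s hs
    rw [tsW, if_pos (by linarith [hs.2])]
  have e2 : ∀ s ∈ Ioc ((t₀ + T) / 2) ((u + T) / 2),
      tsW t₀ T m s = 2 * m * (2 * s - T) ^ (m - 1) := by
    intro s hs
    rw [tsW, if_neg (by linarith [hs.1])]
  have l1 : t₀ ≤ (t₀ + T) / 2 := by linarith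
  have l2 : (t₀ + T) / 2 ≤ (u + T) / 2 := by linarith
  have i2 : IntervalIntegrable (fun s : ℝ => 2 * (m : ℝ) * (2 * s - T) ^ (m - 1)) volume
      ((t₀ + T) / 2) ((u + T) / 2) := (by fun_prop : Continuous _).intervalIntegrable _ _
  have I1 : IntervalIntegrable (tsW t₀ T m) volume t₀ ((t₀ + T) / 2) := by
    refine (intervalIntegrable_const (c := 2 * t₀ ^ m / (T - t₀))).congr ?_
    intro s hs
    rw [uIoc_of_le l1] at hs
    exact (e1 s hs).symm
  have I2 : IntervalIntegrable (tsW t₀ T m) volume ((t₀ + T) / 2) ((u + T) / 2) := by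
    refine i2.congr ?_
    intro s hs
    rw [uIoc_of_le l2] at hs
    exact (e2 s hs).symm
  have J1 : ∫ s in t₀..((t₀ + T) / 2), tsW t₀ T m s = t₀ ^ m := by
    rw [intervalIntegral.integral_of_le l1, setIntegral_congr_fun measurableSet_Ioc e1,
      ← intervalIntegral.integral_of_le l1, intervalIntegral.integral_const, smul_eq_mul]
    have : T - t₀ ≠ 0 := by linarith
    field_simp
    ring
  have J2 : ∫ s in ((t₀ + T) / 2)..((u + T) / 2), tsW t₀ T m s = u ^ m - t₀ ^ m := by
    rw [intervalIntegral.integral_of_le l2, setIntegral_congr_fun measurableSet_Ioc e2,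
      ← intervalIntegral.integral_of_le l2,
      intervalIntegral.integral_eq_sub_of_hasDerivAt (f := fun s => (2 * s - T) ^ m) ?_ i2]
    · ring_nf
    · intro s _
      have := (((hasDerivAt_id s).const_mul 2).sub_const T).pow m
      refine this.congr_deriv ?_
      simp
      ring
  rw [h1, ← intervalIntegral.integral_add_adjacent_intervals I1 I2, J1, J2]
  ring

theorem stmt_2 (t₀ T : ℝ) (ht : t₀ < T) (m n : ℕ) (hm : 1 ≤ m) :
    ∃ F : Lp ℝ 2 (volume.restrict (Icc t₀ T)) →L[ℝ] Lp ℝ 2 (volume.restrict (Icc t₀ T)),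
      (∀ g : Lp ℝ 2 (volume.restrict (Icc t₀ T)),
        (F g : ℝ → ℝ) =ᵐ[volume.restrict (Icc t₀ T)]
          fun t => ∫ τ in Icc t₀ T,
            (t ^ n * τ ^ (m + n) * (if τ ≤ t then 1 else 0)
              + τ ^ n * t ^ (m + n) * (if t < τ then 1 else 0)) * g τ) ∧
      IsTraceClass ℝ F := by
  have : Fact ((1 : ENNReal) ≤ 2) := ⟨by norm_num⟩
  have : Fact ((2 : ENNReal) ≠ ⊤) := ⟨by norm_num⟩
  obtain ⟨e⟩ := ts_basis (ts_infinite t₀ T ht)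
  let q : ℝ → ℝ := fun t => max t₀ (min T t)
  have hq : Measurable q := by fun_prop
  have hqI : ∀ t, q t ∈ Icc t₀ T := fun t =>
    ⟨le_max_left _ _, max_le ht.le (min_le_left _ _)⟩
  have hqid : ∀ t ∈ Icc t₀ T, q t = t := fun t h => by
    simp only [q]
    rw [min_eq_right h.2, max_eq_right h.1]
  obtain ⟨P, hP⟩ := isCompact_Icc.exists_bound_of_continuousOn
      (f := fun x : ℝ => x ^ n) (s := Icc t₀ T) (by fun_prop)
  obtain ⟨Q, hQ⟩ := isCompact_Icc.exists_bound_of_continuousOn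
      (f := fun s : ℝ => 2 * (m : ℝ) * (2 * s - T) ^ (m - 1)) (s := Icc t₀ T) (by fun_prop)
  have hP0 : 0 ≤ P := (norm_nonneg _).trans (hP _ (hqI 0))
  have hW : ∀ s ∈ Icc t₀ T, |tsW t₀ T m s| ≤ max |2 * t₀ ^ m / (T - t₀)| Q := by
    intro s hs
    unfold tsW
    split_ifs
    · exact le_max_left _ _
    · exact (hQ s hs).trans (le_max_right _ _)
  have hWm : Measurable (tsW t₀ T m) := by
    unfold tsW
    refine Measurable.ite ?_ (by fun_prop) (by fun_prop)
    exact measurableSet_le (by fun_prop) (by fun_prop)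
  have hInd : ∀ x y : ℝ, |(if 2 * x ≤ y + T then (1 : ℝ) else 0)| ≤ 1 := by
    intro x y
    split_ifs <;> simp
  let a : ℝ → ℝ → ℝ := fun t s => (q t) ^ n * (if 2 * s ≤ t + T then 1 else 0)
  let b : ℝ → ℝ → ℝ := fun s τ =>
    (q τ) ^ n * (if 2 * s ≤ τ + T then 1 else 0) * tsW t₀ T m (q s)
  have ha : Measurable (Function.uncurry a) := by
    refine ((hq.comp measurable_fst).pow_const n).mul
      (Measurable.ite ?_ measurable_const measurable_const)
    exact measurableSet_le (by fun_prop) (by fun_prop)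
  have hb : Measurable (Function.uncurry b) := by
    refine (((hq.comp measurable_snd).pow_const n).mul
      (Measurable.ite ?_ measurable_const measurable_const)).mul (hWm.comp (hq.comp measurable_fst))
    exact measurableSet_le (by fun_prop) (by fun_prop)
  have haC : ∀ t s, |a t s| ≤ P * 1 := by
    intro t s
    simp only [a]
    rw [abs_mul]
    exact mul_le_mul (hP _ (hqI t)) (hInd _ _) (abs_nonneg _) hP0
  have hbD : ∀ s τ, |b s τ| ≤ P * 1 * max |2 * t₀ ^ m / (T - t₀)| Q := by
    intro s τ
    simp only [b]
    rw [abs_mul, abs_mul]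
    exact mul_le_mul (mul_le_mul (hP _ (hqI τ)) (hInd _ _) (abs_nonneg _) hP0)
      (hW _ (hqI s)) (abs_nonneg _) (by linarith)
  obtain ⟨A, hA, hAHS⟩ := ts_kernel (μ := volume.restrict (Icc t₀ T)) a ha _ haC e
  obtain ⟨B, hB, hBHS⟩ := ts_kernel (μ := volume.restrict (Icc t₀ T)) b hb _ hbD e
  refine ⟨A.comp B, fun g => ?_, A, B, hAHS, hBHS, rfl⟩
  have key : ∀ t ∈ Icc t₀ T, ∀ τ ∈ Icc t₀ T, ∫ s in Icc t₀ T, a t s * b s τ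
      = t ^ n * τ ^ n * (min t τ) ^ m := by
    intro t hti τ hτi
    rw [← tsW_integral t₀ T ht m (min t τ) ⟨le_min hti.1 hτi.1, (min_le_left _ _).trans hti.2⟩,
      ← integral_const_mul]
    refine setIntegral_congr_fun measurableSet_Icc fun s hs => ?_
    simp only [a, b]
    rw [hqid t hti, hqid τ hτi, hqid s hs]
    rcases le_total t τ with h | h
    · rw [min_eq_left h]
      by_cases h1 : 2 * s ≤ t + T
      · have h2 : 2 * s ≤ τ + T := by linarith
        simp only [h1, h2, if_true]
        ring
      · simp [h1]
    · rw [min_eq_right h]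
      by_cases h1 : 2 * s ≤ τ + T
      · have h2 : 2 * s ≤ t + T := by linarith
        simp only [h1, h2, if_true]
        ring
      · simp [h1]
  have hmemI : ∀ᵐ t ∂(volume.restrict (Icc t₀ T)), t ∈ Icc t₀ T :=
    ae_restrict_mem measurableSet_Icc
  filter_upwards [ts_comp a b ha _ haC hb _ hbD A B hA hB g, hmemI] with t h1 hti
  rw [ContinuousLinearMap.comp_apply, h1]
  refine setIntegral_congr_fun measurableSet_Icc fun τ hτi => ?_
  rw [key t hti τ hτi]
  congr 1
  by_cases h : τ ≤ t
  · rw [min_eq_right h, if_pos h, if_neg (not_lt.2 h)]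
    ring
  · rw [min_eq_left (not_le.1 h).le, if_neg h, if_pos (not_le.1 h)]
    ring
end
end

section
/- For m, n ∈ ℤ with m ≠ 0, the integral operator on L²([t₀,T]; ℂ) with kernel f(t,τ) = e^{i n t}·e^{i m τ}·𝟙(τ ≤ t) + e^{i n τ}·e^{i m t}·𝟙(t < τ) is a trace class operator. -/
open MeasureTheory Set

noncomputable section

variable {𝕜 H : Type*} [RCLike 𝕜] [NormedAddCommGroup H] [InnerProductSpace 𝕜 H]

theorem exists_natBasis (t₀ T : ℝ) (ht : t₀ < T) :
    Nonempty (HilbertBasis ℕ ℂ (Lp ℂ 2 (volume.restrict (Icc t₀ T)))) := by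
  set μ := volume.restrict (Icc t₀ T) with hμ
  obtain ⟨w, b, hb⟩ := exists_hilbertBasis ℂ (Lp ℂ 2 μ)
  have : Fact ((2 : ENNReal) ≠ ⊤) := ⟨by simp⟩
  have hc : Countable w := by
    refine Pairwise.countable_of_isOpen_disjoint (α := Lp ℂ 2 μ)
      (s := fun i : w => Metric.ball (b i) (1/2)) ?_ (fun i => Metric.isOpen_ball)
      (fun i => ⟨b i, Metric.mem_ball_self (by norm_num)⟩)
    intro i j hij
    apply Metric.ball_disjoint_ball
    have h1 : ‖b i - b j‖ ^ 2 = 2 := by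
      rw [@norm_sub_sq ℂ, b.orthonormal.1 i, b.orthonormal.1 j, b.orthonormal.2 hij]
      norm_num
    rw [dist_eq_norm]
    nlinarith [norm_nonneg (b i - b j)]
  have hi : Infinite w := by
    by_contra hfin
    rw [not_infinite_iff_finite] at hfin
    have := Fintype.ofFinite w
    have : FiniteDimensional ℂ (Lp ℂ 2 μ) := b.toOrthonormalBasis.toBasis.finiteDimensional_of_finite
    let x : ℕ → ℝ := fun k => t₀ + (T - t₀) / (k + 1)
    let E : ℕ → Set ℝ := fun k => Ioc (x (k+1)) (x k)
    have hanti : Antitone x := by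
      intro k l hkl
      have : (k : ℝ) ≤ l := by exact_mod_cast hkl
      have h2 : 0 < T - t₀ := by linarith
      simp only [x]
      gcongr
    have hE : ∀ k, MeasurableSet (E k) := fun k => measurableSet_Ioc
    have hdis : Pairwise (Function.onFun Disjoint E) := by
      exact hanti.pairwise_disjoint_on_Ioc_succ
    have hpos : ∀ k, μ.real (E k) ≠ 0 := by
      intro k
      have hlt : x (k+1) < x k := by
        have h2 : 0 < T - t₀ := by linarith
        simp only [x]
        push_cast
        gcongr
        linarith
      have hsub : E k ⊆ Icc t₀ T := by
        intro y hy
        have h2 : 0 < T - t₀ := by linarith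
        have h0 : x 0 = T := by simp [x]
        have h3 := hanti (Nat.zero_le k)
        have h4 : t₀ ≤ x (k+1) := by
          simp only [x]
          have : 0 ≤ (T - t₀) / (((k+1 : ℕ) : ℝ) + 1) := by positivity
          linarith
        exact ⟨by linarith [hy.1], by linarith [hy.2]⟩
      rw [hμ, measureReal_restrict_apply (hE k), inter_eq_left.2 hsub]
      simp only [E]
      rw [Real.volume_real_Ioc_of_le hlt.le]
      linarith
    have hin : ∀ i j, inner ℂ (indicatorConstLp 2 (hE i) (measure_ne_top μ _) (1:ℂ))
        (indicatorConstLp 2 (hE j) (measure_ne_top μ _) (1:ℂ)) = (μ.real (E i ∩ E j) : ℂ) :=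
      fun i j => L2.inner_indicatorConstLp_one_indicatorConstLp_one (hE i) (hE j) _ _
    have hli : LinearIndependent ℂ
        (fun k => indicatorConstLp 2 (hE k) (measure_ne_top μ _) (1:ℂ)) := by
      apply linearIndependent_of_ne_zero_of_inner_eq_zero
      · intro i h0
        have := hin i i
        rw [h0, inner_zero_left, inter_self] at this
        exact hpos i (by exact_mod_cast this.symm)
      · intro i j hij
        simp only [hin]
        rw [(hdis hij).inter_eq]; simp
    exact Infinite.not_finite hli.finite 
  obtain ⟨e⟩ := nonempty_equiv_of_countable (α := ℕ) (β := w)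
  refine ⟨HilbertBasis.mk (v := fun k => b (e k)) (b.orthonormal.comp _ e.injective) ?_⟩
  have : range (fun k => b (e k)) = range b := e.surjective.range_comp b
  rw [this, b.dense_span]

theorem kernel_op (μ : Measure ℝ) [IsFiniteMeasure μ] (b : HilbertBasis ℕ ℂ (Lp ℂ 2 μ))
    (k : ℝ → ℝ → ℂ) (hk : Measurable (Function.uncurry k)) (C : ℝ) (hC0 : 0 ≤ C)
    (hC : ∀ t τ, ‖k t τ‖ ≤ C) :
    ∃ A : Lp ℂ 2 μ →L[ℂ] Lp ℂ 2 μ, (∀ g : Lp ℂ 2 μ, A g =ᵐ[μ] fun t => ∫ τ, k t τ * g τ ∂μ) ∧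
      Summable fun i => ‖A (b i)‖ ^ 2 := by
  have hkt : ∀ t, Measurable (k t) := fun t => hk.comp measurable_prodMk_left
  have hm : ∀ t, MemLp (fun τ => (starRingEnd ℂ) (k t τ)) 2 μ := fun t =>
    MemLp.of_bound (Complex.continuous_conj.measurable.comp (hkt t)).aestronglyMeasurable C
      (Filter.Eventually.of_forall fun τ => by simpa using hC t τ)
  let φ : ℝ → Lp ℂ 2 μ := fun t => (hm t).toLp _
  obtain ⟨D, hD0, hD⟩ : ∃ D : ℝ, 0 ≤ D ∧ ∀ t, ‖φ t‖ ≤ D := by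
    refine ⟨_, by positivity, fun t => Lp.norm_le_of_ae_bound hC0 ?_⟩
    filter_upwards [(hm t).coeFn_toLp] with τ hτ
    simp only [φ]
    rw [hτ]; simpa using hC t τ
  have hφ : ∀ t (g : Lp ℂ 2 μ), inner ℂ (φ t) g = ∫ τ, k t τ * g τ ∂μ := by
    intro t g
    rw [L2.inner_def]
    apply integral_congr_ae
    filter_upwards [(hm t).coeFn_toLp] with τ hτ
    simp only [φ]
    rw [hτ]; simp [mul_comm]
  have hmeas : ∀ g : Lp ℂ 2 μ, AEStronglyMeasurable (fun t => inner ℂ (φ t) g) μ := by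
    intro g
    simp only [hφ]
    apply StronglyMeasurable.aestronglyMeasurable
    apply StronglyMeasurable.integral_prod_right (f := fun t τ => k t τ * g τ)
    exact hk.stronglyMeasurable.mul ((Lp.stronglyMeasurable g).comp_measurable measurable_snd)
  have hbd : ∀ t (g : Lp ℂ 2 μ), ‖inner ℂ (φ t) g‖ ≤ D * ‖g‖ := fun t g =>
    (norm_inner_le_norm _ _).trans (by gcongr; exact hD t)
  have hmem : ∀ g : Lp ℂ 2 μ, MemLp (fun t => inner ℂ (φ t) g) 2 μ := fun g =>
    MemLp.of_bound (hmeas g) (D * ‖g‖) (Filter.Eventually.of_forall fun t => hbd t g)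
  let L : Lp ℂ 2 μ →ₗ[ℂ] Lp ℂ 2 μ :=
    { toFun := fun g => (hmem g).toLp _
      map_add' := fun g h => by
        rw [← MemLp.toLp_add]
        congr 1
        ext t
        simp [inner_add_right]
      map_smul' := fun c g => by
        rw [RingHom.id_apply, ← MemLp.toLp_const_smul]
        congr 1
        ext t
        simp [inner_smul_right] }
  have hL : ∀ g, L g =ᵐ[μ] fun t => inner ℂ (φ t) g := fun g => (hmem g).coeFn_toLp
  let A := L.mkContinuous (measureUnivNNReal μ ^ (2:ENNReal).toReal⁻¹ * D) (fun g => by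
    rw [mul_assoc]
    apply Lp.norm_le_of_ae_bound (by positivity)
    filter_upwards [hL g] with t h
    rw [h]; exact hbd t g)
  have hA : ∀ g, A g =ᵐ[μ] fun t => inner ℂ (φ t) g := hL
  refine ⟨A, fun g => by simpa only [hφ] using hA g, ?_⟩
  have hnorm : ∀ g, ‖A g‖ ^ 2 = ∫ t, ‖inner ℂ (φ t) g‖ ^ 2 ∂μ := by
    intro g
    have h1 : ((‖A g‖ ^ 2 : ℝ) : ℂ) = inner ℂ (A g) (A g) := by
      rw [inner_self_eq_norm_sq_to_K]; simp
    have h2 : inner ℂ (A g) (A g) = ((∫ t, ‖inner ℂ (φ t) g‖ ^ 2 ∂μ : ℝ) : ℂ) := by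
      rw [L2.inner_def, ← integral_complex_ofReal]
      apply integral_congr_ae
      filter_upwards [hA g] with t h
      rw [h, inner_self_eq_norm_sq_to_K]; simp
    exact_mod_cast h1.trans h2
  have hint : ∀ g, Integrable (fun t => ‖inner ℂ (φ t) g‖ ^ 2) μ := fun g =>
    (memLp_two_iff_integrable_sq_norm (hmeas g)).1 (hmem g)
  refine summable_of_sum_le (c := ∫ t, D ^ 2 ∂μ) (fun i => by positivity) fun s => ?_
  simp only [hnorm]
  rw [← integral_finsetSum _ fun i _ => hint _]
  apply integral_mono (integrable_finsetSum _ fun i _ => hint _) (integrable_const _)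
  intro t
  have h := b.orthonormal.sum_inner_products_le (s := s) (φ t)
  simp only [norm_inner_symm (φ t)]
  exact h.trans (by have := hD t; gcongr)

def rho (t₀ T : ℝ) (c : ℂ) (s : ℝ) : ℂ :=
  if s ≤ (t₀ + T) / 2 then -2 * c * Complex.exp (c * ((2 * s - t₀ : ℝ) : ℂ))
  else Complex.exp (c * T) * (2 / (T - t₀) : ℝ)

theorem measurable_rho (t₀ T : ℝ) (c : ℂ) : Measurable (rho t₀ T c) := by
  unfold rho
  apply Measurable.ite measurableSet_Iic
  · fun_prop
  · fun_prop

theorem rho_bound (t₀ T : ℝ) (n m : ℤ) : ∃ C : ℝ, 0 ≤ C ∧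
    ∀ s, ‖rho t₀ T (Complex.I * ((n - m : ℤ) : ℂ)) s‖ ≤ C := by
  have he : ∀ x : ℝ, ‖Complex.exp (Complex.I * ((n - m : ℤ) : ℂ) * x)‖ = 1 := by
    intro x
    rw [Complex.norm_exp]
    simp
  refine ⟨2 * ‖Complex.I * ((n - m : ℤ) : ℂ)‖ + ‖((2 / (T - t₀) : ℝ) : ℂ)‖, by positivity,
    fun s => ?_⟩
  unfold rho
  split_ifs
  · rw [norm_mul, he, norm_mul]
    norm_num
    positivity
  · rw [norm_mul, he, one_mul]
    have : 0 ≤ 2 * ‖Complex.I * ((n - m : ℤ) : ℂ)‖ := by positivity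
    linarith

theorem rho_integral (t₀ T : ℝ) (ht : t₀ < T) (c : ℂ) (M : ℝ) (hM : M ∈ Icc t₀ T) :
    ∫ s in Icc t₀ T, (if M ≤ 2 * s - t₀ then rho t₀ T c s else 0) = Complex.exp (c * M) := by
  obtain ⟨hM1, hM2⟩ := hM
  have h1 : (fun s => if M ≤ 2 * s - t₀ then rho t₀ T c s else 0)
      = (Ici ((M + t₀) / 2)).indicator (rho t₀ T c) := by
    ext s
    simp only [indicator, mem_Ici]
    have : M ≤ 2 * s - t₀ ↔ (M + t₀) / 2 ≤ s := by constructor <;> intro h <;> linarith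
    simp [this]
  rw [h1, setIntegral_indicator measurableSet_Ici]
  have h2 : Icc t₀ T ∩ Ici ((M + t₀) / 2) = Icc ((M + t₀) / 2) T := by
    ext s
    simp only [mem_inter_iff, mem_Icc, mem_Ici]
    constructor
    · rintro ⟨⟨_, h⟩, h'⟩; exact ⟨h', h⟩
    · rintro ⟨h, h'⟩; exact ⟨⟨by linarith, h'⟩, h⟩
  have hp : (M + t₀) / 2 ≤ (t₀ + T) / 2 := by linarith
  have hq : (t₀ + T) / 2 ≤ T := by linarith
  have e1 : EqOn (fun s : ℝ => -2 * c * Complex.exp (c * ((2 * s - t₀ : ℝ) : ℂ))) (rho t₀ T c)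
      (uIoc ((M + t₀) / 2) ((t₀ + T) / 2)) := by
    intro s hs
    rw [uIoc_of_le hp] at hs
    simp [rho, hs.2]
  have e2 : EqOn (fun s : ℝ => Complex.exp (c * T) * (2 / (T - t₀) : ℝ)) (rho t₀ T c)
      (uIoc ((t₀ + T) / 2) T) := by
    intro s hs
    rw [uIoc_of_le hq] at hs
    simp [rho, hs.1]
  have i1 : IntervalIntegrable (fun s : ℝ => -2 * c * Complex.exp (c * ((2 * s - t₀ : ℝ) : ℂ)))
      volume ((M + t₀) / 2) ((t₀ + T) / 2) := Continuous.intervalIntegrable (by fun_prop) _ _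
  have i2 : IntervalIntegrable (fun s : ℝ => Complex.exp (c * T) * (2 / (T - t₀) : ℝ))
      volume ((t₀ + T) / 2) T := Continuous.intervalIntegrable (by fun_prop) _ _
  rw [h2, integral_Icc_eq_integral_Ioc, ← intervalIntegral.integral_of_le (hp.trans hq),
    ← intervalIntegral.integral_add_adjacent_intervals (i1.congr e1) (i2.congr e2),
    ← intervalIntegral.integral_congr_ae (Filter.Eventually.of_forall fun s hs => e1 hs),
    ← intervalIntegral.integral_congr_ae (Filter.Eventually.of_forall fun s hs => e2 hs)]
  have d : ∀ s : ℝ, HasDerivAt (fun s : ℝ => - Complex.exp (c * ((2 * s - t₀ : ℝ) : ℂ)))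
      (-2 * c * Complex.exp (c * ((2 * s - t₀ : ℝ) : ℂ))) s := by
    intro s
    have a1 : HasDerivAt (fun s : ℝ => 2 * s - t₀) 2 s := by
      simpa using ((hasDerivAt_id s).const_mul 2).sub_const t₀
    have a2 := ((a1.ofReal_comp.const_mul c).cexp).neg
    convert! a2 using 1
    push_cast; ring
  rw [intervalIntegral.integral_eq_sub_of_hasDerivAt (fun s _ => d s) i1,
    intervalIntegral.integral_const]
  have x1 : 2 * ((t₀ + T) / 2) - t₀ = T := by ring
  have x2 : 2 * ((M + t₀) / 2) - t₀ = M := by ring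
  have x3 : ((T - (t₀ + T) / 2 : ℝ) : ℂ) * ((2 / (T - t₀) : ℝ) : ℂ) = 1 := by
    norm_cast
    have : T - t₀ ≠ 0 := by linarith
    field_simp
    ring
  rw [x1, x2, Complex.real_smul, mul_left_comm, x3]
  ring

theorem stmt_3 (t₀ T : ℝ) (ht : t₀ < T) (m n : ℤ) (hm : m ≠ 0) :
    ∃ F : Lp ℂ 2 (volume.restrict (Icc t₀ T)) →L[ℂ] Lp ℂ 2 (volume.restrict (Icc t₀ T)),
      (∀ g : Lp ℂ 2 (volume.restrict (Icc t₀ T)),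
        (F g : ℝ → ℂ) =ᵐ[volume.restrict (Icc t₀ T)]
          fun t => ∫ τ in Icc t₀ T,
            (Complex.exp (Complex.I * n * t) * Complex.exp (Complex.I * m * τ)
                * (if τ ≤ t then 1 else 0)
              + Complex.exp (Complex.I * n * τ) * Complex.exp (Complex.I * m * t)
                * (if t < τ then 1 else 0)) * g τ) ∧
      IsTraceClass ℂ F := by
  obtain ⟨b⟩ := exists_natBasis t₀ T ht
  obtain ⟨C, hC0, hC⟩ := rho_bound t₀ T n m
  set c : ℂ := Complex.I * ((n - m : ℤ) : ℂ) with hc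
  set μ := volume.restrict (Icc t₀ T) with hμ
  let v : ℝ → ℂ := fun t => Complex.exp (Complex.I * m * t)
  have hv : ∀ t, ‖v t‖ = 1 := by
    intro t
    simp only [v]
    rw [Complex.norm_exp]
    simp
  have hvm : Measurable v := by fun_prop
  let ka : ℝ → ℝ → ℂ := fun t s => if t ≤ 2 * s - t₀ then v t else 0
  let kb : ℝ → ℝ → ℂ := fun s τ => if τ ≤ 2 * s - t₀ then v τ * rho t₀ T c s else 0
  have hka : Measurable (Function.uncurry ka) := by
    apply Measurable.ite
    · exact measurableSet_le (by fun_prop) (by fun_prop)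
    · exact hvm.comp measurable_fst
    · fun_prop
  have hkb : Measurable (Function.uncurry kb) := by
    apply Measurable.ite
    · exact measurableSet_le (by fun_prop) (by fun_prop)
    · exact (hvm.comp measurable_snd).mul ((measurable_rho t₀ T c).comp measurable_fst)
    · fun_prop
  have hkab : ∀ t s, ‖ka t s‖ ≤ 1 := by
    intro t s
    simp only [ka]
    split_ifs
    · rw [hv]
    · simp
  have hkbb : ∀ t s, ‖kb t s‖ ≤ C := by
    intro t s
    simp only [kb]
    split_ifs
    · rw [norm_mul, hv, one_mul]; exact hC _
    · simpa using hC0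
  obtain ⟨A, hA, hAs⟩ := kernel_op μ b ka hka 1 zero_le_one hkab
  obtain ⟨B, hB, hBs⟩ := kernel_op μ b kb hkb C hC0 hkbb
  refine ⟨A.comp B, fun g => ?_, A, B, ⟨b, hAs⟩, ⟨b, hBs⟩, rfl⟩
  have hmemI : ∀ᵐ t ∂μ, t ∈ Icc t₀ T := ae_restrict_mem measurableSet_Icc
  filter_upwards [hA (B g), hmemI] with t h htI
  rw [ContinuousLinearMap.comp_apply, h]
  have hg : Integrable g μ := (Lp.memLp g).integrable (by norm_num)
  have s1 : ∫ s, ka t s * (B g) s ∂μ = ∫ s, ∫ τ, ka t s * kb s τ * g τ ∂μ ∂μ := by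
    apply integral_congr_ae
    filter_upwards [hB g] with s hs
    rw [hs, ← integral_const_mul]
    simp only [mul_assoc]
  have hint : Integrable (Function.uncurry fun s τ => ka t s * kb s τ * g τ) (μ.prod μ) := by
    have h0 : Integrable (fun p : ℝ × ℝ => g p.2) (μ.prod μ) := hg.comp_snd μ
    refine Integrable.bdd_mul (c := 1 * C) h0 ?_ (Filter.Eventually.of_forall fun p => ?_)
    · apply Measurable.aestronglyMeasurable
      exact (hka.comp (measurable_const.prodMk measurable_fst)).mul hkb
    · rw [norm_mul]
      exact mul_le_mul (hkab _ _) (hkbb _ _) (norm_nonneg _) zero_le_one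
  rw [s1, integral_integral_swap hint]
  apply integral_congr_ae
  filter_upwards [hmemI] with τ hτI
  rw [integral_mul_const]
  congr 1
  have hmax : max t τ ∈ Icc t₀ T := ⟨le_max_of_le_left htI.1, max_le htI.2 hτI.2⟩
  have s2 : ∀ s, ka t s * kb s τ
      = v t * v τ * (if max t τ ≤ 2 * s - t₀ then rho t₀ T c s else 0) := by
    intro s
    simp only [ka, kb, max_le_iff]
    by_cases h1 : t ≤ 2 * s - t₀ <;> by_cases h2 : τ ≤ 2 * s - t₀ <;> simp [h1, h2, mul_assoc]
  simp only [s2]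
  rw [integral_const_mul, rho_integral t₀ T ht c _ hmax]
  simp only [v, hc]
  rcases le_or_gt τ t with h1 | h1
  · rw [max_eq_left h1]
    simp only [h1, h1.not_gt, if_true, if_false, mul_one, mul_zero, add_zero]
    rw [← Complex.exp_add, ← Complex.exp_add, ← Complex.exp_add]
    congr 1; push_cast; ring
  · rw [max_eq_right h1.le]
    simp only [h1, h1.not_ge, if_true, if_false, mul_one, mul_zero, zero_add]
    rw [← Complex.exp_add, ← Complex.exp_add, ← Complex.exp_add]
    congr 1; push_cast; ring
end
end

section
/- Let {P̂ᵢ} denote the Legendre polynomials shifted and normalized to be an orthonormal basis of L²([t₀,T]). For any polynomials φ and ψ, the operator with kernel f(t,τ) = φ(t)ψ(τ)𝟙(τ ≤ t) + ψ(t)φ(τ)𝟙(t < τ) on [t₀,T]² is a trace class operator on L²([t₀,T]). -/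
open MeasureTheory Set

noncomputable section

variable {𝕜 H : Type*} [RCLike 𝕜] [NormedAddCommGroup H] [InnerProductSpace 𝕜 H]

theorem aux_countable {E : Type*} [NormedAddCommGroup E] [InnerProductSpace ℝ E]
    [SecondCountableTopology E] {ι : Type*} (v : ι → E) (hv : Orthonormal ℝ v) :
    Countable ι := by
  have key : ∀ i j, i ≠ j → (2 : ℝ) ≤ ‖v i - v j‖ ^ 2 := by
    intro i j hij
    rw [@norm_sub_sq_real, hv.2 hij, hv.1 i, hv.1 j]
    norm_num
  refine Pairwise.countable_of_isOpen_disjoint (s := fun i => Metric.ball (v i) (1 / 2)) ?_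
    (fun i => Metric.isOpen_ball) (fun i => ⟨v i, by simp⟩)
  intro i j hij
  refine Metric.ball_disjoint_ball ?_
  rw [dist_eq_norm]
  nlinarith [key i j hij, norm_nonneg (v i - v j)]

theorem aux_basis {E : Type*} [NormedAddCommGroup E] [InnerProductSpace ℝ E] [CompleteSpace E]
    [SecondCountableTopology E] (hE : ¬ Module.Finite ℝ E) : Nonempty (HilbertBasis ℕ ℝ E) := by
  obtain ⟨w, b, hb⟩ := exists_hilbertBasis ℝ E
  have h1 : Countable w := aux_countable b b.orthonormal
  have h2 : Infinite w := by
    by_contra h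
    rw [not_infinite_iff_finite] at h
    apply hE
    have hd := b.dense_span
    have hfin : FiniteDimensional ℝ (Submodule.span ℝ (Set.range b)) :=
      FiniteDimensional.span_of_finite ℝ (Set.finite_range b)
    have hc : IsClosed (Submodule.span ℝ (Set.range b) : Set E) :=
      Submodule.closed_of_finiteDimensional _
    rw [hc.submodule_topologicalClosure_eq] at hd
    rw [Module.finite_def, ← hd]
    exact Submodule.fg_span (Set.finite_range b)
  obtain ⟨e⟩ := nonempty_equiv_of_countable (α := ℕ) (β := w)
  refine ⟨HilbertBasis.mk (v := fun n => b (e n)) (b.orthonormal.comp e e.injective) ?_⟩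
  have : Set.range (fun n => b (e n)) = Set.range b := e.surjective.range_comp b
  rw [this, b.dense_span]

theorem aux_inf (t₀ T : ℝ) (ht : t₀ < T) :
    ¬ Module.Finite ℝ (Lp ℝ 2 (volume.restrict (Icc t₀ T))) := by
  intro hfin
  have hmem : ∀ p : Polynomial ℝ, MemLp (fun x => p.eval x) 2 (volume.restrict (Icc t₀ T)) := by
    intro p
    obtain ⟨C, hC⟩ := isCompact_Icc.exists_bound_of_continuousOn
      (p.continuous.continuousOn (s := Icc t₀ T))
    refine MemLp.of_bound p.continuous.aestronglyMeasurable C ?_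
    filter_upwards [ae_restrict_mem measurableSet_Icc] with x hx using hC x hx
  let L : Polynomial ℝ →ₗ[ℝ] Lp ℝ 2 (volume.restrict (Icc t₀ T)) :=
    { toFun := fun p => (hmem p).toLp _
      map_add' := by
        intro p q
        rw [← MemLp.toLp_add]
        exact MemLp.toLp_congr _ _ (by filter_upwards with x; simp)
      map_smul' := by
        intro c q
        rw [RingHom.id_apply, ← MemLp.toLp_const_smul]
        exact MemLp.toLp_congr _ _ (by filter_upwards with x; simp) }
  have hL : Function.Injective L := by
    intro p q hpq
    have h : (fun x => p.eval x) =ᵐ[volume.restrict (Icc t₀ T)] fun x => q.eval x :=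
      (MemLp.toLp_eq_toLp_iff (hmem p) (hmem q)).1 hpq
    have h2 : EqOn (fun x => p.eval x) (fun x => q.eval x) (Icc t₀ T) :=
      Measure.eqOn_Icc_of_ae_eq volume ht.ne h p.continuous.continuousOn q.continuous.continuousOn
    exact Polynomial.eq_of_infinite_eval_eq p q ((Icc_infinite ht).mono h2)
  exact Polynomial.not_finite (R := ℝ) (Module.Finite.of_injective L hL)

theorem aux_kernel {μ : Measure ℝ} [IsFiniteMeasure μ] (S : Set ℝ) (hS : ∀ᵐ x ∂μ, x ∈ S)
    (k : ℝ → ℝ → ℝ) (hk : Measurable (Function.uncurry k)) (C : ℝ) (hC0 : 0 ≤ C)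
    (hC : ∀ t ∈ S, ∀ τ ∈ S, |k t τ| ≤ C) (b : HilbertBasis ℕ ℝ (Lp ℝ 2 μ)) :
    ∃ K : Lp ℝ 2 μ →L[ℝ] Lp ℝ 2 μ,
      (∀ g : Lp ℝ 2 μ, (K g : ℝ → ℝ) =ᵐ[μ] fun t => ∫ τ, k t τ * g τ ∂μ) ∧
      IsHilbertSchmidt ℝ K := by
  have hkm : ∀ t ∈ S, MemLp (k t) 2 μ := by
    intro t ht
    refine MemLp.of_bound (hk.of_uncurry_left).aestronglyMeasurable C ?_
    filter_upwards [hS] with τ hτ using hC t ht τ hτ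
  set M : ℝ := (measureUnivNNReal μ : ℝ) ^ (2 : ENNReal).toReal⁻¹ with hM
  have hM0 : 0 ≤ M := by positivity
  have hkn : ∀ t (ht : t ∈ S), ‖(hkm t ht).toLp (k t)‖ ≤ M * C := by
    intro t ht
    refine Lp.norm_le_of_ae_bound hC0 ?_
    filter_upwards [(hkm t ht).coeFn_toLp, hS] with τ h1 hτ
    rw [h1]; exact hC t ht τ hτ
  have hin : ∀ t (ht : t ∈ S) (g : Lp ℝ 2 μ),
      ∫ τ, k t τ * g τ ∂μ = inner ℝ g ((hkm t ht).toLp (k t)) := by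
    intro t ht g
    rw [L2.inner_def]
    refine integral_congr_ae ?_
    filter_upwards [(hkm t ht).coeFn_toLp] with τ h1
    rw [h1]; simp
  have hb : ∀ t ∈ S, ∀ g : Lp ℝ 2 μ, ‖∫ τ, k t τ * g τ ∂μ‖ ≤ M * C * ‖g‖ := by
    intro t ht g
    rw [hin t ht g]
    refine (norm_inner_le_norm _ _).trans ?_
    rw [mul_comm]
    exact mul_le_mul_of_nonneg_right (hkn t ht) (norm_nonneg _)
  have hmeas : ∀ g : Lp ℝ 2 μ, StronglyMeasurable (fun t => ∫ τ, k t τ * g τ ∂μ) := by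
    intro g
    refine StronglyMeasurable.integral_prod_right (f := fun t τ => k t τ * g τ) ?_
    exact hk.stronglyMeasurable.mul ((Lp.stronglyMeasurable g).comp_measurable measurable_snd)
  have hmem : ∀ g : Lp ℝ 2 μ, MemLp (fun t => ∫ τ, k t τ * g τ ∂μ) 2 μ := by
    intro g
    refine MemLp.of_bound (hmeas g).aestronglyMeasurable (M * C * ‖g‖) ?_
    filter_upwards [hS] with t ht using hb t ht g
  let K0 : Lp ℝ 2 μ →ₗ[ℝ] Lp ℝ 2 μ :=
    { toFun := fun g => (hmem g).toLp _
      map_add' := by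
        intro p q
        rw [← MemLp.toLp_add]
        refine MemLp.toLp_congr _ _ ?_
        filter_upwards [hS] with t ht
        rw [Pi.add_apply, hin t ht, hin t ht, hin t ht, inner_add_left]
      map_smul' := by
        intro c q
        rw [RingHom.id_apply, ← MemLp.toLp_const_smul]
        refine MemLp.toLp_congr _ _ ?_
        filter_upwards [hS] with t ht
        rw [Pi.smul_apply, hin t ht, hin t ht, inner_smul_left]
        simp }
  have hK0 : ∀ g, (K0 g : ℝ → ℝ) =ᵐ[μ] fun t => ∫ τ, k t τ * g τ ∂μ :=
    fun g => (hmem g).coeFn_toLp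
  let K : Lp ℝ 2 μ →L[ℝ] Lp ℝ 2 μ := K0.mkContinuous (M * (M * C)) (by
    intro g
    have : ‖K0 g‖ ≤ M * (M * C * ‖g‖) := by
      refine Lp.norm_le_of_ae_bound (by positivity) ?_
      filter_upwards [hK0 g, hS] with t h1 ht
      rw [h1]; exact hb t ht g
    linarith)
  refine ⟨K, hK0, b, ?_⟩
  refine summable_of_sum_le (c := ∫ _t, (M * C) ^ 2 ∂μ) (fun i => by positivity) ?_
  intro u
  have hn : ∀ i, ‖K (b i)‖ ^ 2 = ∫ t, (∫ τ, k t τ * b i τ ∂μ) ^ 2 ∂μ := by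
    intro i
    rw [← real_inner_self_eq_norm_sq, L2.inner_def]
    refine integral_congr_ae ?_
    filter_upwards [hK0 (b i)] with t h1
    have h1' : (K (b i) : ℝ → ℝ) t = ∫ τ, k t τ * b i τ ∂μ := h1
    rw [h1']; simp [sq]
  simp_rw [hn]
  have hint : ∀ i, Integrable (fun t => (∫ τ, k t τ * b i τ ∂μ) ^ 2) μ :=
    fun i => (hmem (b i)).integrable_sq
  rw [← integral_finsetSum _ (fun i _ => hint i)]
  refine integral_mono_ae (integrable_finsetSum _ (fun i _ => hint i)) (integrable_const _) ?_
  filter_upwards [hS] with t ht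
  have hbes := b.orthonormal.sum_inner_products_le ((hkm t ht).toLp (k t)) (s := u)
  refine le_trans (le_of_eq ?_) (hbes.trans (pow_le_pow_left₀ (norm_nonneg _) (hkn t ht) 2))
  refine Finset.sum_congr rfl fun i _ => ?_
  rw [hin t ht, Real.norm_eq_abs, sq_abs]

theorem aux_compute (t₀ T : ℝ) (ht : t₀ < T) (φ ψ : Polynomial ℝ) (t : ℝ) (htm : t ∈ Icc t₀ T)
    (τ : ℝ) (hτ : τ ∈ Icc t₀ T) :
    ∫ x in t₀..t, (if τ ≤ x then φ.derivative.eval x * ψ.eval τ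
        else ψ.derivative.eval x * φ.eval τ)
      = φ.eval t * ψ.eval τ * (if τ ≤ t then 1 else 0)
              + ψ.eval t * φ.eval τ * (if t < τ then 1 else 0) - ψ.eval t₀ * φ.eval τ := by
  have ftc : ∀ (p : Polynomial ℝ) (c a b : ℝ),
      ∫ x in a..b, p.derivative.eval x * c = (p.eval b - p.eval a) * c := by
    intro p c a b
    rw [intervalIntegral.integral_mul_const,
      intervalIntegral.integral_eq_sub_of_hasDerivAt (fun x _ => p.hasDerivAt x)
        (p.derivative.continuous.intervalIntegrable _ _)]
  have hlow : ∀ u, t₀ ≤ u → u ≤ τ → ∀ᵐ x : ℝ, x ∈ uIoc t₀ u → 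
      ψ.derivative.eval x * φ.eval τ = (if τ ≤ x then φ.derivative.eval x * ψ.eval τ
        else ψ.derivative.eval x * φ.eval τ) := by
    intro u hu huτ
    have : ∀ᵐ x : ℝ, x ≠ τ := by simp [ae_iff, measure_singleton]
    filter_upwards [this] with x hx hxm
    rw [uIoc_of_le hu] at hxm
    have h : x < τ := lt_of_le_of_ne (hxm.2.trans huτ) hx
    rw [if_neg (not_le.2 h)]
  have hup : τ ≤ t → ∀ x ∈ uIcc τ t,
      φ.derivative.eval x * ψ.eval τ = (if τ ≤ x then φ.derivative.eval x * ψ.eval τ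
        else ψ.derivative.eval x * φ.eval τ) := by
    intro h x hx
    rw [uIcc_of_le h] at hx
    rw [if_pos hx.1]
  by_cases h : τ ≤ t
  · rw [← intervalIntegral.integral_add_adjacent_intervals (b := τ),
      ← intervalIntegral.integral_congr_ae (hlow τ hτ.1 le_rfl),
      ← intervalIntegral.integral_congr (hup h), ftc, ftc, if_pos h, if_neg (not_lt.2 h)]
    · ring
    · refine IntervalIntegrable.congr_ae 
        (f := fun x => ψ.derivative.eval x * φ.eval τ)
        ((ψ.derivative.continuous.mul continuous_const).intervalIntegrable _ _) ?_
      rw [Filter.EventuallyEq, ae_restrict_iff' measurableSet_uIoc]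
      exact hlow τ hτ.1 le_rfl
    · refine IntervalIntegrable.congr 
        (f := fun x => φ.derivative.eval x * ψ.eval τ) ?_
        ((φ.derivative.continuous.mul continuous_const).intervalIntegrable _ _)
      exact fun x hx => hup h x (uIoc_subset_uIcc hx)
  · push Not at h
    rw [← intervalIntegral.integral_congr_ae (hlow t htm.1 h.le), ftc, if_neg (not_le.2 h),
      if_pos h]
    ring

/-- The left factor kernel. -/
def kerA (t₀ T : ℝ) (t s : ℝ) : ℝ :=
  if s ≤ (t + t₀) / 2 ∨ (t₀ + T) / 2 < s then 1 else 0

/-- The right factor kernel. -/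
def kerB (t₀ T : ℝ) (φ ψ : Polynomial ℝ) (s τ : ℝ) : ℝ :=
  if s ≤ (t₀ + T) / 2 then
    2 * (if τ ≤ 2 * s - t₀ then φ.derivative.eval (2 * s - t₀) * ψ.eval τ
        else ψ.derivative.eval (2 * s - t₀) * φ.eval τ)
  else (ψ.eval t₀ / (T - (t₀ + T) / 2)) * φ.eval τ

theorem kerA_meas (t₀ T : ℝ) : Measurable (Function.uncurry (kerA t₀ T)) := by
  unfold kerA Function.uncurry
  refine Measurable.ite ?_ measurable_const measurable_const
  have h1 : MeasurableSet {p : ℝ × ℝ | p.2 ≤ (p.1 + t₀) / 2} :=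
    measurableSet_le (by fun_prop) (by fun_prop)
  have h2 : MeasurableSet {p : ℝ × ℝ | (t₀ + T) / 2 < p.2} :=
    measurableSet_lt (by fun_prop) (by fun_prop)
  exact h1.union h2

theorem kerB_meas (t₀ T : ℝ) (φ ψ : Polynomial ℝ) :
    Measurable (Function.uncurry (kerB t₀ T φ ψ)) := by
  have hp : ∀ p : Polynomial ℝ, Measurable fun x => p.eval x := fun p => p.continuous.measurable
  have h1 : ∀ p : Polynomial ℝ, Measurable fun x : ℝ × ℝ => p.eval x.2 :=
    fun p => (hp p).comp measurable_snd
  have h2 : ∀ p : Polynomial ℝ, Measurable fun x : ℝ × ℝ => p.eval (2 * x.1 - t₀) :=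
    fun p => (hp p).comp (by fun_prop)
  unfold kerB Function.uncurry
  refine Measurable.ite (measurableSet_le (by fun_prop) (by fun_prop)) ?_
    (measurable_const.mul (h1 φ))
  refine measurable_const.mul ?_
  exact Measurable.ite (measurableSet_le (by fun_prop) (by fun_prop))
    ((h2 _).mul (h1 _)) ((h2 _).mul (h1 _))

theorem kerA_bound (t₀ T t s : ℝ) : |kerA t₀ T t s| ≤ 1 := by
  unfold kerA
  split_ifs <;> simp

theorem kerB_bound (t₀ T : ℝ) (φ ψ : Polynomial ℝ) :
    ∃ C : ℝ, 0 ≤ C ∧ ∀ s ∈ Icc t₀ T, ∀ τ ∈ Icc t₀ T, |kerB t₀ T φ ψ s τ| ≤ C := by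
  have hb : ∀ p : Polynomial ℝ, ∃ C : ℝ, 0 ≤ C ∧ ∀ x ∈ Icc t₀ T, |p.eval x| ≤ C := by
    intro p
    obtain ⟨C, hC⟩ := isCompact_Icc.exists_bound_of_continuousOn
      (p.continuous.continuousOn (s := Icc t₀ T))
    exact ⟨max C 0, le_max_right _ _, fun x hx => (hC x hx).trans (le_max_left _ _)⟩
  obtain ⟨C1, h10, h1⟩ := hb φ
  obtain ⟨C2, h20, h2⟩ := hb ψ
  obtain ⟨C3, h30, h3⟩ := hb φ.derivative
  obtain ⟨C4, h40, h4⟩ := hb ψ.derivative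
  set c := ψ.eval t₀ / (T - (t₀ + T) / 2) with hc
  refine ⟨2 * (C3 * C2) + 2 * (C4 * C1) + |c| * C1, by positivity, ?_⟩
  intro s hs τ hτ
  have e1 : 0 ≤ C3 * C2 := by positivity
  have e2 : 0 ≤ C4 * C1 := by positivity
  have e3 : 0 ≤ |c| * C1 := by positivity
  unfold kerB
  rw [← hc]
  split_ifs with ha hb'
  · have hm : 2 * s - t₀ ∈ Icc t₀ T := ⟨by linarith [hs.1], by linarith⟩
    have := mul_le_mul (h3 _ hm) (h2 _ hτ) (abs_nonneg _) h30
    rw [abs_mul, abs_mul, abs_two]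
    linarith
  · have hm : 2 * s - t₀ ∈ Icc t₀ T := ⟨by linarith [hs.1], by linarith⟩
    have := mul_le_mul (h4 _ hm) (h1 _ hτ) (abs_nonneg _) h40
    rw [abs_mul, abs_mul, abs_two]
    linarith
  · have := mul_le_mul_of_nonneg_left (h1 _ hτ) (abs_nonneg c)
    rw [abs_mul]
    linarith

theorem aux_ab (t₀ T : ℝ) (ht : t₀ < T) (φ ψ : Polynomial ℝ) (t : ℝ) (htm : t ∈ Icc t₀ T)
    (τ : ℝ) (hτ : τ ∈ Icc t₀ T) :
    ∫ s in Icc t₀ T, kerA t₀ T t s * kerB t₀ T φ ψ s τ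
      = φ.eval t * ψ.eval τ * (if τ ≤ t then 1 else 0)
              + ψ.eval t * φ.eval τ * (if t < τ then 1 else 0) := by
  obtain ⟨C, hC0, hC⟩ := kerB_bound t₀ T φ ψ
  have hI : IntegrableOn (fun s => kerA t₀ T t s * kerB t₀ T φ ψ s τ) (Icc t₀ T) := by
    refine Integrable.of_bound (C := 1 * C) ?_ ?_
    · exact ((kerA_meas t₀ T).of_uncurry_left.mul
        (kerB_meas t₀ T φ ψ).of_uncurry_right).aestronglyMeasurable
    · filter_upwards [ae_restrict_mem measurableSet_Icc] with s hs
      rw [norm_mul]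
      exact mul_le_mul (kerA_bound t₀ T t s) (hC s hs τ hτ) (norm_nonneg _) zero_le_one
  have hII : ∀ a b, t₀ ≤ a → a ≤ b → b ≤ T →
      IntervalIntegrable (fun s => kerA t₀ T t s * kerB t₀ T φ ψ s τ) volume a b := by
    intro a b h1 h2 h3
    rw [intervalIntegrable_iff_integrableOn_Icc_of_le h2]
    exact hI.mono_set (Icc_subset_Icc h1 h3)
  obtain ⟨ht1, ht2⟩ := htm
  rw [integral_Icc_eq_integral_Ioc, ← intervalIntegral.integral_of_le ht.le,
    ← intervalIntegral.integral_add_adjacent_intervals (b := (t₀ + T) / 2)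
      (hII _ _ (by linarith) (by linarith) (by linarith))
      (hII _ _ (by linarith) (by linarith) (by linarith)),
    ← intervalIntegral.integral_add_adjacent_intervals (b := (t + t₀) / 2) (c := (t₀ + T) / 2)
      (hII _ _ (by linarith) (by linarith) (by linarith))
      (hII _ _ (by linarith) (by linarith) (by linarith))]
  have p3 : ∫ s in (t₀ + T) / 2..T, kerA t₀ T t s * kerB t₀ T φ ψ s τ = ψ.eval t₀ * φ.eval τ := by
    have : ∫ s in (t₀ + T) / 2..T, kerA t₀ T t s * kerB t₀ T φ ψ s τ
        = ∫ s in (t₀ + T) / 2..T, (ψ.eval t₀ / (T - (t₀ + T) / 2)) * φ.eval τ := by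
      refine intervalIntegral.integral_congr_ae (Filter.Eventually.of_forall fun s hs => ?_)
      rw [uIoc_of_le (by linarith)] at hs
      unfold kerA kerB
      rw [if_pos (Or.inr hs.1), if_neg (not_le.2 hs.1), one_mul]
    rw [this, intervalIntegral.integral_const, smul_eq_mul]
    have : T - (t₀ + T) / 2 ≠ 0 := by
      have : 0 < T - (t₀ + T) / 2 := by linarith
      exact this.ne'
    rw [← mul_assoc, mul_div_cancel₀ _ this]
  have p2 : ∫ s in (t + t₀) / 2..(t₀ + T) / 2, kerA t₀ T t s * kerB t₀ T φ ψ s τ = 0 := by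
    have : ∫ s in (t + t₀) / 2..(t₀ + T) / 2, kerA t₀ T t s * kerB t₀ T φ ψ s τ
        = ∫ s in (t + t₀) / 2..(t₀ + T) / 2, (0 : ℝ) := by
      refine intervalIntegral.integral_congr_ae (Filter.Eventually.of_forall fun s hs => ?_)
      rw [uIoc_of_le (by linarith)] at hs
      unfold kerA
      rw [if_neg, zero_mul]
      rintro (h | h)
      · exact absurd h (not_le.2 hs.1)
      · exact absurd hs.2 (not_le.2 h)
    rw [this]; simp
  have p1 : ∫ s in t₀..(t + t₀) / 2, kerA t₀ T t s * kerB t₀ T φ ψ s τ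
      = ∫ x in t₀..t, (if τ ≤ x then φ.derivative.eval x * ψ.eval τ
        else ψ.derivative.eval x * φ.eval τ) := by
    have h2 := intervalIntegral.mul_integral_comp_mul_sub (a := t₀) (b := (t + t₀) / 2)
      (f := fun x => (if τ ≤ x then φ.derivative.eval x * ψ.eval τ
        else ψ.derivative.eval x * φ.eval τ)) (2 : ℝ) t₀
    have e1 : 2 * t₀ - t₀ = t₀ := by ring
    have e2 : 2 * ((t + t₀) / 2) - t₀ = t := by ring
    rw [e1, e2] at h2
    rw [← h2, ← intervalIntegral.integral_const_mul]
    refine intervalIntegral.integral_congr_ae (Filter.Eventually.of_forall fun s hs => ?_)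
    rw [uIoc_of_le (by linarith)] at hs
    unfold kerA kerB
    rw [if_pos (Or.inl hs.2), if_pos (by linarith [hs.2]), one_mul]
  rw [p1, p2, p3, aux_compute t₀ T ht φ ψ t ⟨ht1, ht2⟩ τ hτ]
  ring

theorem stmt_11 (t₀ T : ℝ) (ht : t₀ < T) (φ ψ : Polynomial ℝ) :
    ∃ F : Lp ℝ 2 (volume.restrict (Icc t₀ T)) →L[ℝ] Lp ℝ 2 (volume.restrict (Icc t₀ T)),
      (∀ g : Lp ℝ 2 (volume.restrict (Icc t₀ T)),
        (F g : ℝ → ℝ) =ᵐ[volume.restrict (Icc t₀ T)]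
          fun t => ∫ τ in Icc t₀ T,
            (φ.eval t * ψ.eval τ * (if τ ≤ t then 1 else 0)
              + ψ.eval t * φ.eval τ * (if t < τ then 1 else 0)) * g τ) ∧
      IsTraceClass ℝ F := by

  have : Fact ((2 : ENNReal) ≠ ⊤) := ⟨by norm_num⟩
  obtain ⟨b⟩ := aux_basis (aux_inf t₀ T ht)
  have hS : ∀ᵐ x ∂(volume.restrict (Icc t₀ T)), x ∈ Icc t₀ T := ae_restrict_mem measurableSet_Icc
  obtain ⟨C, hC0, hC⟩ := kerB_bound t₀ T φ ψ
  obtain ⟨A, hA, hA2⟩ := aux_kernel (Icc t₀ T) hS (kerA t₀ T) (kerA_meas t₀ T) 1 zero_le_one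
    (fun t _ s _ => kerA_bound t₀ T t s) b
  obtain ⟨B, hB, hB2⟩ := aux_kernel (Icc t₀ T) hS (kerB t₀ T φ ψ) (kerB_meas t₀ T φ ψ) C hC0 hC b
  refine ⟨A.comp B, ?_, A, B, hA2, hB2, rfl⟩
  intro g
  have hAB := hA (B g)
  filter_upwards [hAB, hS] with t h1 htm
  rw [ContinuousLinearMap.comp_apply, h1]
  have hg : Integrable g (volume.restrict (Icc t₀ T)) := (Lp.memLp g).integrable (by norm_num)
  calc ∫ s in Icc t₀ T, kerA t₀ T t s * (B g) s
      = ∫ s in Icc t₀ T, ∫ τ in Icc t₀ T, kerA t₀ T t s * kerB t₀ T φ ψ s τ * g τ := by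
        refine integral_congr_ae ?_
        filter_upwards [hB g] with s hs
        rw [hs, ← integral_const_mul]
        simp_rw [mul_assoc]
    _ = ∫ τ in Icc t₀ T, ∫ s in Icc t₀ T, kerA t₀ T t s * kerB t₀ T φ ψ s τ * g τ := by
        refine integral_integral_swap ?_
        refine Integrable.bdd_mul (c := 1 * C) (f := fun p : ℝ × ℝ =>
          kerA t₀ T t p.1 * kerB t₀ T φ ψ p.1 p.2) (hg.comp_snd _) ?_ ?_
        · exact (((kerA_meas t₀ T).of_uncurry_left.comp measurable_fst).mul
            (kerB_meas t₀ T φ ψ)).aestronglyMeasurable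
        · rw [Measure.prod_restrict]
          filter_upwards [ae_restrict_mem (measurableSet_Icc.prod measurableSet_Icc)] with p hp
          rw [norm_mul]
          exact mul_le_mul (kerA_bound t₀ T t p.1) (hC _ hp.1 _ hp.2) (norm_nonneg _) zero_le_one
    _ = _ := by
        refine integral_congr_ae ?_
        filter_upwards [hS] with τ hτ
        rw [integral_mul_const, aux_ab t₀ T ht φ ψ t htm τ hτ]
end
end
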